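/- arXiv:1802.02000 — 3 statements merged into one kernel-verified Lean document; each statement's English description precedes it below -/
import Mathlib

section
/- Every non-trivial finite subgroup of PGL(2,ℤ) has cardinality 2, 3, 4, or 6. -/
open Matrix

abbrev GL2Z := GL (Fin 2) ℤ

/-- PGL(2,ℤ): the quotient of GL(2,ℤ) by its center {I, -I}. -/
abbrev PGL2Z := GL2Z ⧸ Subgroup.center GL2Z

/-- The image of a matrix in PGL(2,ℤ). -/
def cls (M : GL2Z) : PGL2Z := QuotientGroup.mk M

def Smat : GL2Z := ⟨!![0,1;1,0], !![0,1;1,0], by decide, by decide⟩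
def Nmat : GL2Z := ⟨!![-1,0;0,1], !![-1,0;0,1], by decide, by decide⟩
def Tmat : GL2Z := ⟨!![0,-1;1,0], !![0,1;-1,0], by decide, by decide⟩
def Umat : GL2Z := ⟨!![0,-1;1,1], !![1,1;-1,0], by decide, by decide⟩

lemma pow_form (g : Matrix (Fin 2) (Fin 2) ℤ) (hd : g.det = 1) (ht : 2 ≤ |g 0 0 + g 1 1|) (n : ℕ) :
    ∃ u v : ℤ, g ^ (n + 1) = u • g - v • (1 : Matrix (Fin 2) (Fin 2) ℤ) ∧ |v| + 1 ≤ |u| := by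
  induction n with
  | zero => exact ⟨1, 0, by simp, by simp⟩
  | succ n ih =>
    obtain ⟨u, v, h, huv⟩ := ih
    refine ⟨(g 0 0 + g 1 1) * u - v, u, ?_, ?_⟩
    · have hsq : g * g = (g 0 0 + g 1 1) • g - 1 := by
        rw [Matrix.det_fin_two] at hd
        ext i j
        fin_cases i <;> fin_cases j <;> simp [Matrix.mul_apply, Fin.sum_univ_two, -zsmul_eq_mul] <;> linarith
      rw [pow_succ, h, sub_mul, smul_mul_assoc, hsq, smul_mul_assoc, one_mul]
      module
    · have h1 : |(g 0 0 + g 1 1) * u| - |v| ≤ |(g 0 0 + g 1 1) * u - v| := abs_sub_abs_le_abs_sub _ _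
      rw [abs_mul] at h1
      nlinarith [abs_nonneg u, abs_nonneg v]

/-- g is a scalar matrix -/
def IsScal (g : Matrix (Fin 2) (Fin 2) ℤ) : Prop := g 0 1 = 0 ∧ g 1 0 = 0 ∧ g 0 0 = g 1 1

lemma scal_of_pow (g : Matrix (Fin 2) (Fin 2) ℤ) (hd : g.det = 1) (ht : 2 ≤ |g 0 0 + g 1 1|)
    (n : ℕ) (hn : 0 < n) (hs : IsScal (g ^ n)) : IsScal g := by
  obtain ⟨m, rfl⟩ : ∃ m, n = m + 1 := ⟨n - 1, by omega⟩
  obtain ⟨u, v, h, huv⟩ := pow_form g hd ht m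
  have hu : u ≠ 0 := by
    rintro rfl
    have := abs_nonneg v
    simp at huv
    omega
  rw [h] at hs
  obtain ⟨h1, h2, h3⟩ := hs
  simp only [Matrix.sub_apply, Matrix.smul_apply, Matrix.one_apply, smul_eq_mul] at h1 h2 h3
  simp [hu] at h1 h2 h3
  exact ⟨h1, h2, h3⟩

lemma mem_center_iff_scal (g : GL2Z) : g ∈ Subgroup.center GL2Z ↔ IsScal g.val := by
  constructor
  · intro h
    rw [Subgroup.mem_center_iff] at h
    have h1 := congrArg Units.val (h Smat)
    have h2 := congrArg Units.val (h Nmat)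
    simp only [Units.val_mul, Smat, Nmat] at h1 h2
    have a := congrFun (congrFun h1 0) 1
    have b := congrFun (congrFun h2 0) 1
    have c := congrFun (congrFun h2 1) 0
    simp [Matrix.mul_apply, Fin.sum_univ_two] at a b c
    exact ⟨by omega, by omega, by omega⟩
  · rintro ⟨h1, h2, h3⟩
    rw [Subgroup.mem_center_iff]
    intro k
    apply Units.ext
    ext i j
    fin_cases i <;> fin_cases j <;> simp [Matrix.mul_apply, Fin.sum_univ_two, h1, h2, h3, mul_comm]

lemma scal_det_odd (g : GL2Z) (h : IsScal g.val) : g.val 0 0 = 1 ∨ g.val 0 0 = -1 := by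
  have := (Matrix.isUnit_iff_isUnit_det g.val).1 g.isUnit
  obtain ⟨h1, h2, h3⟩ := h
  rw [Matrix.det_fin_two, h1, ← h3] at this
  simp at this
  exact Int.isUnit_iff.1 this

noncomputable def detHom : PGL2Z →* ℤˣ :=
  QuotientGroup.lift _ (Matrix.GeneralLinearGroup.det : GL2Z →* ℤˣ) (by
    intro g hg
    rw [mem_center_iff_scal] at hg
    have h0 := scal_det_odd g hg
    obtain ⟨h1, h2, h3⟩ := hg
    apply Units.ext
    rw [Matrix.GeneralLinearGroup.val_det_apply, Matrix.det_fin_two, h1, ← h3]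
    rcases h0 with h | h <;> simp [h])

noncomputable def redHom : PGL2Z →* GL (Fin 2) (ZMod 2) :=
  QuotientGroup.lift _ (Matrix.GeneralLinearGroup.map (Int.castRingHom (ZMod 2))) (by
    intro g hg
    rw [mem_center_iff_scal] at hg
    have h0 := scal_det_odd g hg
    obtain ⟨h1, h2, h3⟩ := hg
    apply Units.ext
    ext i j
    fin_cases i <;> fin_cases j <;>
      rcases h0 with h | h <;> simp [h1, h2, ← h3, h])

/-- lift facts for elements of a finite subgroup with det 1 -/
lemma exists_lift (x : PGL2Z) (hx : detHom x = 1) :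
    ∃ g : GL2Z, QuotientGroup.mk g = x ∧ g.val.det = 1 ∧
      ∀ i j, (redHom x).val i j = ((g.val i j : ℤ) : ZMod 2) := by
  obtain ⟨g, rfl⟩ := QuotientGroup.mk_surjective x
  refine ⟨g, rfl, ?_, ?_⟩
  · have := congrArg Units.val hx
    exact this
  · intro i j
    rfl

lemma scal_of_finOrder (g : GL2Z) (hd : g.val.det = 1)
    (hf : IsOfFinOrder (QuotientGroup.mk g : PGL2Z)) (ht : 2 ≤ |g.val 0 0 + g.val 1 1|) :
    IsScal g.val := by
  obtain ⟨n, hn, h⟩ := isOfFinOrder_iff_pow_eq_one.1 hf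
  rw [← QuotientGroup.mk_pow, QuotientGroup.eq_one_iff, mem_center_iff_scal] at h
  exact scal_of_pow _ hd ht n hn (by simpa using h)

lemma red_inj (x : PGL2Z) (hx : detHom x = 1) (hf : IsOfFinOrder x) (hr : redHom x = 1) :
    x = 1 := by
  obtain ⟨g, rfl, hd, hg⟩ := exists_lift x hx
  rw [QuotientGroup.eq_one_iff, mem_center_iff_scal]
  apply scal_of_finOrder g hd hf
  rw [hr] at hg
  have h00 := hg 0 0
  have h01 := hg 0 1
  have h10 := hg 1 0
  have h11 := hg 1 1
  simp at h00 h01 h10 h11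
  have e00 : (2:ℤ) ∣ g.val 0 0 - 1 := (ZMod.intCast_zmod_eq_zero_iff_dvd _ 2).1 (by simp [← h00])
  have e11 : (2:ℤ) ∣ g.val 1 1 - 1 := (ZMod.intCast_zmod_eq_zero_iff_dvd _ 2).1 (by simp [← h11])
  have e01 : (2:ℤ) ∣ g.val 0 1 := (ZMod.intCast_zmod_eq_zero_iff_dvd _ 2).1 (by simp [← h01])
  have e10 : (2:ℤ) ∣ g.val 1 0 := (ZMod.intCast_zmod_eq_zero_iff_dvd _ 2).1 (by simp [← h10])
  by_contra hlt
  rw [not_le, abs_lt] at hlt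
  obtain ⟨a, ha⟩ := e00
  obtain ⟨d, hd'⟩ := e11
  obtain ⟨b, hb⟩ := e01
  obtain ⟨c, hc⟩ := e10
  rw [Matrix.det_fin_two, hb, hc, show g.val 0 0 = 2 * a + 1 by omega,
    show g.val 1 1 = -(2 * a + 1) by omega] at hd
  have : 4 * (-a * a - a - b * c) = 2 := by linarith
  omega

/-- Two trace zero matrices -/
lemma trace_zero_eq (a b c a' b' c' : ℤ) (h : -a * a - b * c = 1) (h' : -a' * a' - b' * c' = 1) :
    2 ≤ |2 * a * a' + b * c' + c * b'| := by
  have hb : b ≠ 0 := by rintro rfl; nlinarith [mul_self_nonneg a]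
  have hb' : b' ≠ 0 := by rintro rfl; nlinarith [mul_self_nonneg a']
  have key : b * b' * (2 * a * a' + b * c' + c * b') = -((a * b' - a' * b) ^ 2 + b ^ 2 + b' ^ 2) := by
    linear_combination (-b' ^ 2) * h - b ^ 2 * h'
  have k2 := congrArg abs key
  rw [abs_mul, abs_neg, abs_of_nonneg (by positivity : 0 ≤ (a * b' - a' * b) ^ 2 + b ^ 2 + b' ^ 2),
    abs_mul] at k2
  have p1 : 0 < |b| := abs_pos.2 hb
  have p2 : 0 < |b'| := abs_pos.2 hb'
  rw [← sq_abs b, ← sq_abs b'] at k2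
  have p3 : 0 < |b| * |b'| := by positivity
  by_contra hlt
  rw [not_le] at hlt
  nlinarith [sq_nonneg (|b| - |b'|), sq_nonneg (a * b' - a' * b)]

lemma trace_zero_of (x : PGL2Z) (hf : IsOfFinOrder x) (g : GL2Z) (hgx : QuotientGroup.mk g = x)
    (hd : g.val.det = 1) (hg : ∀ i j, (redHom x).val i j = ((g.val i j : ℤ) : ZMod 2))
    (hne : redHom x ≠ 1) (htr : (redHom x).val 0 0 + (redHom x).val 1 1 = 0) :
    g.val 1 1 = - g.val 0 0 := by
  by_contra hc
  have e : (2:ℤ) ∣ g.val 0 0 + g.val 1 1 := (ZMod.intCast_zmod_eq_zero_iff_dvd _ 2).1 (by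
    push_cast
    rw [← hg, ← hg, htr])
  apply hne
  have : x = 1 := by
    subst hgx
    rw [QuotientGroup.eq_one_iff, mem_center_iff_scal]
    apply scal_of_finOrder g hd hf
    rw [le_abs]
    omega
  rw [this, map_one]

lemma unique_invol (x y : PGL2Z) (hx : detHom x = 1) (hy : detHom y = 1)
    (hfx : IsOfFinOrder x) (hfy : IsOfFinOrder y) (hfxy : IsOfFinOrder (x * y))
    (hnx : redHom x ≠ 1) (hny : redHom y ≠ 1)
    (htx : (redHom x).val 0 0 + (redHom x).val 1 1 = 0)
    (hty : (redHom y).val 0 0 + (redHom y).val 1 1 = 0) : x * y = 1 := by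
  obtain ⟨g, hgx, hd, hg⟩ := exists_lift x hx
  obtain ⟨k, hky, hd', hk⟩ := exists_lift y hy
  have t1 := trace_zero_of x hfx g hgx hd hg hnx htx
  have t2 := trace_zero_of y hfy k hky hd' hk hny hty
  subst hgx hky
  rw [← QuotientGroup.mk_mul] at hfxy ⊢
  rw [QuotientGroup.eq_one_iff, mem_center_iff_scal]
  apply scal_of_finOrder _ (by simp [hd, hd']) hfxy
  rw [Matrix.det_fin_two, t1] at hd
  rw [Matrix.det_fin_two, t2] at hd'
  have := trace_zero_eq (g.val 0 0) (g.val 0 1) (g.val 1 0) (k.val 0 0) (k.val 0 1) (k.val 1 0)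
    (by linarith) (by linarith)
  rw [Units.val_mul, Matrix.mul_apply, Matrix.mul_apply, Fin.sum_univ_two, Fin.sum_univ_two, t1, t2]
  convert this using 2
  ring

lemma card_GL2F2 : Nat.card (GL (Fin 2) (ZMod 2)) = 6 := by
  haveI : Fact (Nat.Prime 2) := ⟨Nat.prime_two⟩
  rw [Matrix.card_GL_field]
  simp [Fin.prod_univ_two]

lemma card_plus (K : Subgroup PGL2Z) [Finite K] (hK : ∀ x ∈ K, detHom x = 1) :
    Nat.card K = 1 ∨ Nat.card K = 2 ∨ Nat.card K = 3 := by
  have hfo : ∀ x ∈ K, IsOfFinOrder x := fun x hx =>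
    K.subtype.isOfFinOrder (isOfFinOrder_of_finite (⟨x, hx⟩ : K))
  let f : K →* GL (Fin 2) (ZMod 2) := redHom.comp K.subtype
  have hinj : Function.Injective f := by
    rw [injective_iff_map_eq_one]
    rintro ⟨x, hx⟩ h
    exact Subtype.ext (red_inj x (hK x hx) (hfo x hx) h)
  have hdvd : Nat.card K ∣ 6 := card_GL2F2 ▸ Subgroup.card_dvd_of_injective f hinj
  have hne : Nat.card K ≠ 6 := by
    intro h6
    have hb : Function.Bijective f :=
      (Nat.bijective_iff_injective_and_card f).2 ⟨hinj, by rw [h6, card_GL2F2]⟩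
    let A : GL (Fin 2) (ZMod 2) := ⟨!![0,1;1,0], !![0,1;1,0], by decide, by decide⟩
    let B : GL (Fin 2) (ZMod 2) := ⟨!![1,1;0,1], !![1,1;0,1], by decide, by decide⟩
    obtain ⟨⟨x, hx⟩, hxA⟩ := hb.2 A
    obtain ⟨⟨y, hy⟩, hyB⟩ := hb.2 B
    have hxA : redHom x = A := hxA
    have hyB : redHom y = B := hyB
    have := unique_invol x y (hK x hx) (hK y hy) (hfo x hx) (hfo y hy) (hfo _ (K.mul_mem hx hy))
      (by rw [hxA]; decide) (by rw [hyB]; decide) (by rw [hxA]; decide) (by rw [hyB]; decide)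
    have h2 := congrArg redHom this
    rw [map_mul, hxA, hyB, map_one] at h2
    revert h2
    decide
  have hle := Nat.le_of_dvd (by norm_num) hdvd
  interval_cases h : Nat.card K <;> omega

/-- Every non-trivial finite subgroup of PGL(2,ℤ) has cardinality 2, 3, 4, or 6. -/
theorem stmt_0 (H : Subgroup PGL2Z) (hfin : Finite H) (hne : H ≠ ⊥) :
    Nat.card H = 2 ∨ Nat.card H = 3 ∨ Nat.card H = 4 ∨ Nat.card H = 6 := by
  let d : H →* ℤˣ := detHom.comp H.subtype
  have h1 : Nat.card d.ker * d.ker.index = Nat.card H := Subgroup.card_mul_index _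
  have h2 : d.ker.index ∣ 2 := by
    rw [Subgroup.index_ker]
    have := Subgroup.card_subgroup_dvd_card d.range
    simpa using this
  have h3 : Nat.card (d.ker.map H.subtype) = Nat.card d.ker :=
    Subgroup.card_map_of_injective H.subtype_injective
  have hf : Finite (d.ker.map H.subtype) := Nat.finite_of_card_ne_zero (by
    rw [h3]; exact Nat.card_pos.ne')
  have h4 := card_plus (d.ker.map H.subtype) (by
    rintro _ ⟨x, hx, rfl⟩
    exact hx)
  have h5 : Nat.card H ≠ 1 := fun h => hne (Subgroup.card_eq_one.1 h)
  rw [h3] at h4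
  rcases (Nat.dvd_prime Nat.prime_two).1 h2 with h | h <;> rw [h] at h1 <;> omega
end

section
/- Every non-trivial finite subgroup of PGL(2,ℤ) is isomorphic (as an abstract group) to the cyclic group of order 2, the cyclic group of order 3, the Klein four-group ℤ/2 × ℤ/2, or the symmetric group S₃ (equivalently, the dihedral group of order 6). -/
open Matrix

theorem fin_abs {G : Type*} [Group G] [Finite G] (φ : G →* ℤˣ) (x : G)
    (hx : ∀ y : G, φ y = 1 → y = 1 ∨ y = x ∨ y = x⁻¹)
    (hsq : ∀ y : G, φ y ≠ 1 → y * y = 1) (hne : Nontrivial G) :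
    Nonempty (G ≃* Multiplicative (ZMod 2)) ∨
    Nonempty (G ≃* Multiplicative (ZMod 3)) ∨
    Nonempty (G ≃* Multiplicative (ZMod 2) × Multiplicative (ZMod 2)) ∨
    Nonempty (G ≃* Equiv.Perm (Fin 3)) := by
  classical
  have hk : Nat.card φ.ker ≤ 3 := by
    have : (φ.ker : Set G) ⊆ ({1, x, x⁻¹} : Finset G) := by
      intro y hy
      have := hx y hy
      simpa using this
    have h2 := Set.ncard_le_ncard this (Finset.finite_toSet _)
    rw [Set.ncard_coe_finset] at h2
    exact h2.trans Finset.card_le_three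
  have hk0 : 0 < Nat.card φ.ker := Nat.card_pos
  have hcard : Nat.card φ.ker * φ.ker.index = Nat.card G := Subgroup.card_mul_index _
  have hr : φ.ker.index ∣ 2 := by
    rw [Subgroup.index_ker]
    have := Subgroup.card_subgroup_dvd_card φ.range
    simpa using this
  have hr' : φ.ker.index = 1 ∨ φ.ker.index = 2 := (Nat.dvd_prime Nat.prime_two).1 hr
  have h1 : 1 < Nat.card G := Finite.one_lt_card
  have e2 : Nat.card G = 2 → Nonempty (G ≃* Multiplicative (ZMod 2)) := fun h => by
    have : Fact (Nat.Prime 2) := ⟨Nat.prime_two⟩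
    exact ⟨mulEquivOfPrimeCardEq (p := 2) h (by simp)⟩
  have e3 : Nat.card G = 3 → Nonempty (G ≃* Multiplicative (ZMod 3)) := fun h => by
    have : Fact (Nat.Prime 3) := ⟨Nat.prime_three⟩
    exact ⟨mulEquivOfPrimeCardEq (p := 3) h (by simp)⟩
  have kp : ∀ y : G, φ y = 1 → y ^ Nat.card φ.ker = 1 := fun y hy => by
    have := pow_card_eq_one' (x := (⟨y, hy⟩ : φ.ker))
    simpa [Subtype.ext_iff] using this
  have hc : (Nat.card φ.ker = 1 ∨ Nat.card φ.ker = 2) ∨ Nat.card φ.ker = 3 := by omega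
  rcases hr' with hi | hi
  · rw [hi] at hcard
    rcases hc with (h | h) | h
    · omega
    · exact Or.inl (e2 (by omega))
    · exact Or.inr (Or.inl (e3 (by omega)))
  · rw [hi] at hcard
    rcases hc with (h | h) | h
    · exact Or.inl (e2 (by omega))
    · right; right; left
      have hall : ∀ y : G, y ^ 2 = 1 := fun y => by
        by_cases hy : φ y = 1
        · have := kp y hy; rwa [h] at this
        · rw [pow_two]; exact hsq y hy
      have kl : ∀ (K : Type _) [Group K] [Finite K], Nat.card K = 4 → (∀ y : K, y ^ 2 = 1) → IsKleinFour K := by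
        intro K _ _ hK hy
        refine ⟨hK, ?_⟩
        have hd : Monoid.exponent K ∣ 2 := Monoid.exponent_dvd_of_forall_pow_eq_one hy
        rcases (Nat.dvd_prime Nat.prime_two).1 hd with h | h
        · rw [Monoid.exp_eq_one_iff] at h
          have := Nat.card_of_subsingleton (1 : K)
          omega
        · exact h
      have := kl G (by omega) hall
      have : IsKleinFour (Multiplicative (ZMod 2) × Multiplicative (ZMod 2)) := by
        refine ⟨by simp, ?_⟩
        have : Monoid.exponent (Multiplicative (ZMod 2) × Multiplicative (ZMod 2)) ∣ 2 :=
          Monoid.exponent_dvd_of_forall_pow_eq_one (by decide)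
        rcases (Nat.dvd_prime Nat.prime_two).1 this with h | h
        · rw [Monoid.exp_eq_one_iff] at h
          exact absurd (h.elim (1, 1) (1, Multiplicative.ofAdd 1)) (by decide)
        · exact h
      exact IsKleinFour.nonempty_mulEquiv
    · right; right; right
      have hG : Nat.card G = 6 := by omega
      have hX : Nat.card {y : G // φ y ≠ 1} = 3 := by
        have := Nat.card_congr (Equiv.sumCompl (fun y : G => φ y = 1))
        rw [Nat.card_sum] at this
        have h3 : Nat.card {y : G // φ y = 1} = 3 := h
        have h4 : Nat.card {y : G // ¬ φ y = 1} = 3 := by omega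
        exact h4
      have conj_ne : ∀ g y : G, φ y ≠ 1 → φ (g * y * g⁻¹) ≠ 1 := fun g y hy h => hy (by
        rwa [map_mul, map_mul, map_inv, mul_inv_cancel_comm] at h)
      have hun : ∀ u v : ℤˣ, u ≠ 1 → v ≠ 1 → u * v = 1 := by decide
      have hk3 : ∀ y : G, φ y = 1 → y * y = 1 → y = 1 := fun y hy h2 => by
        have := kp y hy
        rw [h, pow_succ, pow_two, h2, one_mul] at this
        exact this
      let f : G →* Equiv.Perm {y : G // φ y ≠ 1} :=
        { toFun := fun g =>
            { toFun := fun y => ⟨g * y.1 * g⁻¹, conj_ne g y y.2⟩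
              invFun := fun y => ⟨g⁻¹ * y.1 * g, by simpa using conj_ne g⁻¹ y y.2⟩
              left_inv := fun y => by ext; simp [mul_assoc]
              right_inv := fun y => by ext; simp [mul_assoc] }
          map_one' := by ext; simp
          map_mul' := fun a b => by ext; simp [mul_assoc] }
      have : Nontrivial {y : G // φ y ≠ 1} := (Finite.one_lt_card_iff_nontrivial).1 (by omega)
      have hinj : Function.Injective f := by
        rw [injective_iff_map_eq_one]
        intro g hg
        have hcomm : ∀ s : G, φ s ≠ 1 → g * s = s * g := fun s hs => by
          have := congrArg Subtype.val (DFunLike.congr_fun hg ⟨s, hs⟩)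
          have h5 : g * s * g⁻¹ = s := this
          rwa [mul_inv_eq_iff_eq_mul] at h5
        by_cases hgk : φ g = 1
        · obtain ⟨s, hs⟩ := (inferInstance : Nonempty {y : G // φ y ≠ 1})
          apply hk3 g hgk
          have h6 : (g * s) * (g * s) = 1 := hsq _ (by simpa [hgk] using hs)
          have h7 := hsq s hs
          calc g * g = g * g * (s * s) := by rw [h7, mul_one]
            _ = g * (g * s) * s := by simp only [mul_assoc]
            _ = g * (s * g) * s := by rw [hcomm s hs]
            _ = 1 := by rw [← h6]; simp only [mul_assoc]
        · exfalso
          obtain ⟨⟨s, hs⟩, hsg⟩ := exists_ne (⟨g, hgk⟩ : {y : G // φ y ≠ 1})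
          apply hsg
          have h8 : g * s = 1 := by
            apply hk3
            · rw [map_mul]; exact hun _ _ hgk hs
            · calc g * s * (g * s) = g * (s * g) * s := by simp only [mul_assoc]
                _ = (g * g) * (s * s) := by rw [← hcomm s hs]; simp only [mul_assoc]
                _ = 1 := by rw [hsq g hgk, hsq s hs, one_mul]
          ext
          show s = g
          have h9 := hsq g hgk
          exact mul_left_cancel (h8.trans h9.symm)
      have hbij : Function.Bijective f := by
        rw [Nat.bijective_iff_injective_and_card]
        refine ⟨hinj, ?_⟩
        rw [Nat.card_perm, hX, hG]; rfl
      have e : {y : G // φ y ≠ 1} ≃ Fin 3 := Finite.equivFinOfCardEq hX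
      exact ⟨(MulEquiv.ofBijective f hbij).trans e.permCongrHom⟩

theorem arith_rel (a b c p q r s : ℤ) (hdet : p * s - q * r = 1)
    (h1 : a * p ^ 2 + 2 * b * p * r + c * r ^ 2 = a)
    (h2 : a * p * q + b * (p * s + q * r) + c * r * s = b) :
    a * (s - p) = 2 * b * r ∧ a * q = - c * r := by
  constructor
  · linear_combination (-s) * h1 + r * h2 + (a * p + b * r) * hdet
  · linear_combination (-q) * h1 + p * h2 - (b * p + c * r) * hdet

theorem arith_tr (a b c p q r s : ℤ) (hdet : p * s - q * r = 1)
    (h1 : a * (s - p) = 2 * b * r) (h2 : a * q = - c * r) :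
    (4 - (p + s) ^ 2) * a ^ 2 = 4 * (a * c - b ^ 2) * r ^ 2 := by
  linear_combination (-(a * (s - p)) - 2 * b * r) * h1 - 4 * a * r * h2 - 4 * a ^ 2 * hdet

theorem arith_bd (a b c p q r s : ℤ) (ha : 0 < a) (hD : 0 < a * c - b ^ 2)
    (hdet : p * s - q * r = 1)
    (h1 : a * (s - p) = 2 * b * r) (h2 : a * q = - c * r) :
    (p + s) ^ 2 ≤ 4 := by
  have h := arith_tr a b c p q r s hdet h1 h2
  have h3 : 0 ≤ 4 * (a * c - b ^ 2) * r ^ 2 := by positivity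
  rw [← h] at h3
  have := nonneg_of_mul_nonneg_left h3 (by positivity)
  linarith

theorem arith_zero (a b c p q s : ℤ) (ha : 0 < a)
    (hdet : p * s - q * 0 = 1)
    (h1 : a * (s - p) = 2 * b * 0) (h2 : a * q = - c * 0) :
    q = 0 ∧ s = p ∧ (p = 1 ∨ p = -1) := by
  have hq : q = 0 := by simpa [ha.ne'] using h2
  have hs : s = p := by
    have : s - p = 0 := by simpa [ha.ne'] using h1
    linarith
  subst hs
  refine ⟨hq, rfl, ?_⟩
  have : s ^ 2 = 1 := by linarith
  simpa using this

theorem no34 (u v : ℤ) (hu : u ≠ 0) (h : 3 * u ^ 2 = 4 * v ^ 2) : False := by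
  have hv : v ≠ 0 := by rintro rfl; apply hu; simpa using h
  have h3 : Prime (3 : ℤ) := Int.prime_three
  have h' := congrArg (fun z : ℤ => (2 * z)) h
  have hirr : Irrational (√(3 : ℝ)) := by
    have := Nat.Prime.irrational_sqrt Nat.prime_three
    simpa using this
  apply hirr
  refine ⟨|(2 * v : ℚ) / u|, ?_⟩
  have hu' : (u : ℝ) ≠ 0 := by exact_mod_cast hu
  have hR : 3 * (u : ℝ) ^ 2 = 4 * v ^ 2 := by exact_mod_cast h
  rw [eq_comm, Real.sqrt_eq_iff_mul_self_eq (by norm_num) (by positivity)]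
  push_cast
  rw [abs_mul_abs_self]
  field_simp
  linarith

/-- Two nontrivial elliptic elements with the same fixed form agree up to sign and inversion. -/
theorem arith_two (a b c p q r s p' q' r' s' : ℤ) (ha : 0 < a) (hD : 0 < a * c - b ^ 2)
    (hr : r ≠ 0) (hr' : r' ≠ 0)
    (hdet : p * s - q * r = 1)
    (h1 : a * (s - p) = 2 * b * r) (h2 : a * q = - c * r)
    (hdet' : p' * s' - q' * r' = 1)
    (h1' : a * (s' - p') = 2 * b * r') (h2' : a * q' = - c * r') :
    ∃ e : ℤ, (e = 1 ∨ e = -1) ∧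
      ((p' = e * p ∧ q' = e * q ∧ r' = e * r ∧ s' = e * s) ∨
       (p' = e * s ∧ q' = e * -q ∧ r' = e * -r ∧ s' = e * p)) := by
  have hb := arith_tr a b c p q r s hdet h1 h2
  have hb' := arith_tr a b c p' q' r' s' hdet' h1' h2'
  set D := a * c - b ^ 2 with hDdef
  have ha2 : a ^ 2 ≠ 0 := by positivity
  have bd : ∀ t ρ : ℤ, ρ ≠ 0 → (4 - t ^ 2) * a ^ 2 = 4 * D * ρ ^ 2 → t = -1 ∨ t = 0 ∨ t = 1 := by
    intro t ρ hρ h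
    have : 0 < (4 - t ^ 2) * a ^ 2 := by rw [h]; positivity
    have := pos_of_mul_pos_left this (by positivity)
    have : t < 2 := by nlinarith
    have : -2 < t := by nlinarith
    omega
  have ht := bd _ _ hr hb
  have ht' := bd _ _ hr' hb'
  have key : (4 - (p + s) ^ 2) * r' ^ 2 = (4 - (p' + s') ^ 2) * r ^ 2 := by
    apply mul_left_cancel₀ (show 4 * D ≠ 0 by positivity)
    linear_combination (-(4 - (p + s) ^ 2)) * hb' + (4 - (p' + s') ^ 2) * hb
  have htt : p' + s' = p + s ∨ p' + s' = -(p + s) := by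
    rcases ht with h | h | h <;> rcases ht' with h' | h' | h' <;> rw [h, h'] at key ⊢ <;>
      norm_num at key ⊢
    all_goals first
      | exact no34 r' r hr' (by linarith)
      | exact no34 r r' hr (by linarith)
  have hrr : r' = r ∨ r' = -r := by
    apply sq_eq_sq_iff_eq_or_eq_neg.1
    have e : (p' + s') ^ 2 = (p + s) ^ 2 := sq_eq_sq_iff_eq_or_eq_neg.2 htt
    rw [e] at key
    refine mul_left_cancel₀ ?_ key
    rcases ht with h | h | h <;> rw [h] <;> norm_num
  have ha0 : a ≠ 0 := ha.ne'
  have hq : ∀ e : ℤ, r' = e * r → q' = e * q ∧ s' - p' = e * (s - p) := by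
    intro e he
    constructor <;> apply mul_left_cancel₀ ha0
    · rw [h2', he]; linear_combination (-e) * h2
    · rw [h1', he]; linear_combination (-e) * h1
  rcases htt with h | h <;> rcases hrr with h' | h'
  · have := hq 1 (by linarith)
    exact ⟨1, by simp, Or.inl (by omega)⟩
  · have := hq (-1) (by linarith)
    exact ⟨1, by simp, Or.inr (by omega)⟩
  · have := hq 1 (by linarith)
    exact ⟨-1, by simp, Or.inr (by omega)⟩
  · have := hq (-1) (by linarith)
    exact ⟨-1, by simp, Or.inl (by omega)⟩

theorem mem_center_GL2Z (g : GL2Z) :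
    g ∈ Subgroup.center GL2Z ↔ (g.val = 1 ∨ g.val = -1) := by
  rw [GeneralLinearGroup.mem_center_iff_val_mem_range_scalar]
  constructor
  · rintro ⟨z, hz⟩
    have hd : IsUnit (g.val.det) := (Matrix.isUnit_iff_isUnit_det _).1 g.isUnit
    rw [← hz] at hd ⊢
    simp only [scalar_apply, det_diagonal, Fin.prod_univ_two] at hd
    have := isUnit_of_mul_isUnit_left hd
    rcases Int.isUnit_iff.1 this with rfl | rfl
    · left; simp
    · right; ext i j; fin_cases i <;> fin_cases j <;> simp
  · rintro (h | h)
    · exact ⟨1, by rw [h]; simp⟩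
    · exact ⟨-1, by rw [h]; ext i j; fin_cases i <;> fin_cases j <;> simp⟩

theorem mk_eq_iff (g h : GL2Z) :
    (QuotientGroup.mk g : PGL2Z) = QuotientGroup.mk h ↔ (h.val = g.val ∨ h.val = -g.val) := by
  rw [QuotientGroup.eq, mem_center_GL2Z]
  have : ∀ X : Matrix (Fin 2) (Fin 2) ℤ, (g⁻¹ * h).val = X ↔ h.val = g.val * X := by
    intro X
    rw [Units.val_mul]
    constructor
    · rintro rfl; simp [← mul_assoc]
    · intro hh; rw [hh]; simp [← mul_assoc]
  rw [this, this]; simp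

/-- The determinant on PGL(2,ℤ). -/
noncomputable def detP : PGL2Z →* ℤˣ :=
  QuotientGroup.lift _ GeneralLinearGroup.det (by
    intro g hg
    rcases (mem_center_GL2Z g).1 hg with h | h <;> ext <;> simp [h, Matrix.det_fin_two])

theorem detP_mk (g : GL2Z) : ((detP (QuotientGroup.mk g) : ℤˣ) : ℤ) = g.val.det := rfl

/-- The Gram matrix of a class. -/
noncomputable def gramP (x : PGL2Z) : Matrix (Fin 2) (Fin 2) ℤ :=
  (Quotient.out x).valᵀ * (Quotient.out x).val

theorem gram_mk (g : GL2Z) : gramP (QuotientGroup.mk g) = g.valᵀ * g.val := by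
  unfold gramP
  have : (QuotientGroup.mk (Quotient.out (QuotientGroup.mk g : PGL2Z)) : PGL2Z)
    = QuotientGroup.mk g := Quotient.out_eq _
  rw [mk_eq_iff] at this
  rcases this with h | h <;> rw [h] <;> simp

/-- Positive definiteness, elementary form. -/
def PD (Q : Matrix (Fin 2) (Fin 2) ℤ) : Prop :=
  Q 1 0 = Q 0 1 ∧ ∀ x y : ℤ, (x ≠ 0 ∨ y ≠ 0) →
    0 < Q 0 0 * x ^ 2 + 2 * Q 0 1 * x * y + Q 1 1 * y ^ 2

theorem PD_gram (g : GL2Z) : PD (gramP (QuotientGroup.mk g)) := by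
  rw [gram_mk]
  have hd : IsUnit (g.val.det) := (Matrix.isUnit_iff_isUnit_det _).1 g.isUnit
  have hd0 := hd.ne_zero
  generalize g.val = M at *
  rw [det_fin_two] at hd0
  constructor
  · simp [Matrix.mul_apply, Fin.sum_univ_two]; ring
  · intro x y hxy
    simp only [Matrix.mul_apply, Fin.sum_univ_two, transpose_apply]
    by_contra hcon
    have e1 : (M 0 0 * x + M 0 1 * y) = 0 := by
      nlinarith [sq_nonneg (M 0 0 * x + M 0 1 * y), sq_nonneg (M 1 0 * x + M 1 1 * y)]
    have e2 : (M 1 0 * x + M 1 1 * y) = 0 := by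
      nlinarith [sq_nonneg (M 0 0 * x + M 0 1 * y), sq_nonneg (M 1 0 * x + M 1 1 * y)]
    have f1 : (M 0 0 * M 1 1 - M 0 1 * M 1 0) * x = 0 := by
      linear_combination M 1 1 * e1 - M 0 1 * e2
    have f2 : (M 0 0 * M 1 1 - M 0 1 * M 1 0) * y = 0 := by
      linear_combination M 0 0 * e2 - M 1 0 * e1
    rcases hxy with h | h
    · exact (mul_ne_zero hd0 h) f1
    · exact (mul_ne_zero hd0 h) f2

theorem PD_add (P Q : Matrix (Fin 2) (Fin 2) ℤ) (hP : PD P) (hQ : PD Q) : PD (P + Q) := by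
  refine ⟨by simp [hP.1, hQ.1], fun x y hxy => ?_⟩
  have h1 := hP.2 x y hxy
  have h2 := hQ.2 x y hxy
  simp only [Matrix.add_apply]
  linarith

theorem exists_form (H : Subgroup PGL2Z) (hfin : Finite H) :
    ∃ a b c : ℤ, 0 < a ∧ 0 < a * c - b ^ 2 ∧
      ∀ g : GL2Z, (QuotientGroup.mk g : PGL2Z) ∈ H →
        g.valᵀ * !![a, b; b, c] * g.val = !![a, b; b, c] := by
  classical
  have := Fintype.ofFinite H
  set Q : Matrix (Fin 2) (Fin 2) ℤ := ∑ h : H, gramP h.1 with hQ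
  have hPD : PD Q := by
    apply Finset.sum_induction_nonempty _ PD PD_add Finset.univ_nonempty
    rintro ⟨h, hh⟩ -
    induction h using QuotientGroup.induction_on with
    | H g => exact PD_gram g
  have hinv : ∀ g : GL2Z, (QuotientGroup.mk g : PGL2Z) ∈ H → g.valᵀ * Q * g.val = Q := by
    intro g hg
    conv_rhs => rw [hQ, ← Equiv.sum_comp (Equiv.mulRight (⟨QuotientGroup.mk g, hg⟩ : H))]
    rw [hQ, Matrix.mul_sum, Matrix.sum_mul]
    apply Finset.sum_congr rfl
    rintro ⟨h, hh⟩ -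
    induction h using QuotientGroup.induction_on with
    | H k =>
      have : ((Equiv.mulRight (⟨QuotientGroup.mk g, hg⟩ : H)) ⟨QuotientGroup.mk k, hh⟩).1
        = (QuotientGroup.mk (k * g) : PGL2Z) := rfl
      rw [this, gram_mk, gram_mk]
      simp [Matrix.mul_assoc]
  have hQe : Q = !![Q 0 0, Q 0 1; Q 0 1, Q 1 1] := by
    ext i j; fin_cases i <;> fin_cases j <;> simp [hPD.1]
  have ha : 0 < Q 0 0 := by simpa using hPD.2 1 0 (by simp)
  refine ⟨Q 0 0, Q 0 1, Q 1 1, ha, ?_, ?_⟩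
  · have h := hPD.2 (Q 0 1) (-Q 0 0) (Or.inr (by simpa using ha.ne'))
    have : 0 < Q 0 0 * (Q 0 0 * Q 1 1 - Q 0 1 ^ 2) := by linarith
    exact pos_of_mul_pos_right this ha.le
  · rw [← hQe]; exact hinv

theorem rel_of_inv (a b c : ℤ) (g : GL2Z) (hd : g.val.det = 1)
    (h : g.valᵀ * !![a, b; b, c] * g.val = !![a, b; b, c]) :
    g.val 0 0 * g.val 1 1 - g.val 0 1 * g.val 1 0 = 1 ∧
    a * (g.val 1 1 - g.val 0 0) = 2 * b * g.val 1 0 ∧ a * g.val 0 1 = - c * g.val 1 0 := by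
  rw [det_fin_two] at hd
  refine ⟨hd, ?_⟩
  have e1 := congrFun (congrFun h 0) 0
  have e2 := congrFun (congrFun h 0) 1
  simp [Matrix.mul_apply, Fin.sum_univ_two] at e1 e2
  exact arith_rel a b c _ _ _ _ hd (by linarith) (by linarith)

/-- Every non-trivial finite subgroup of PGL(2,ℤ) is isomorphic to C₂, C₃,
the Klein four-group, or S₃. -/
theorem stmt_9 (H : Subgroup PGL2Z) (hfin : Finite H) (hne : H ≠ ⊥) :
    Nonempty (H ≃* Multiplicative (ZMod 2)) ∨
    Nonempty (H ≃* Multiplicative (ZMod 3)) ∨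
    Nonempty (H ≃* Multiplicative (ZMod 2) × Multiplicative (ZMod 2)) ∨
    Nonempty (H ≃* Equiv.Perm (Fin 3)) := by
  obtain ⟨a, b, c, ha, hD, hinv⟩ := exists_form H hfin
  have hnt : Nontrivial H := (Subgroup.nontrivial_iff_ne_bot H).2 hne
  have hrel : ∀ g : GL2Z, (QuotientGroup.mk g : PGL2Z) ∈ H → g.val.det = 1 → _ :=
    fun g hg hd => rel_of_inv a b c g hd (hinv g hg)
  have hone : ∀ g : GL2Z, (QuotientGroup.mk g : PGL2Z) ∈ H → g.val.det = 1 → g.val 1 0 = 0 →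
      (QuotientGroup.mk g : PGL2Z) = 1 := by
    intro g hg hd h0
    have h := hrel g hg hd
    rw [h0] at h
    obtain ⟨h1, h2, h3⟩ := arith_zero a b c _ _ _ ha h.1 h.2.1 h.2.2
    rw [eq_comm]
    change (QuotientGroup.mk 1 : PGL2Z) = QuotientGroup.mk g
    rw [mk_eq_iff]
    rcases h3 with h3 | h3
    · left; ext i j; fin_cases i <;> fin_cases j <;> simp [h0, h1, h2, h3]
    · right; ext i j; fin_cases i <;> fin_cases j <;> simp [h0, h1, h2, h3]
  let φ : H →* ℤˣ := detP.comp H.subtype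
  have hφ : ∀ (g : GL2Z) (hg : (QuotientGroup.mk g : PGL2Z) ∈ H),
      φ ⟨QuotientGroup.mk g, hg⟩ = 1 ↔ g.val.det = 1 := by
    intro g hg
    rw [Units.ext_iff]
    exact Iff.rfl
  have hx : ∃ x : H, ∀ y : H, φ y = 1 → y = 1 ∨ y = x ∨ y = x⁻¹ := by
    by_cases hex : ∃ g : GL2Z, (QuotientGroup.mk g : PGL2Z) ∈ H ∧ g.val.det = 1 ∧ g.val 1 0 ≠ 0
    · obtain ⟨g, hg, hd, hr⟩ := hex
      refine ⟨⟨QuotientGroup.mk g, hg⟩, ?_⟩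
      rintro ⟨y, hy⟩ hyk
      induction y using QuotientGroup.induction_on with
      | H k =>
        have hkd := (hφ k hy).1 hyk
        by_cases hk0 : k.val 1 0 = 0
        · left; ext; exact hone k hy hkd hk0
        · right
          have e := hrel g hg hd
          have e' := hrel k hy hkd
          obtain ⟨s, hs, h | h⟩ := arith_two a b c _ _ _ _ _ _ _ _ ha hD hr hk0 e.1 e.2.1 e.2.2
            e'.1 e'.2.1 e'.2.2
          · left
            rw [Subtype.ext_iff, eq_comm]
            change (QuotientGroup.mk g : PGL2Z) = QuotientGroup.mk k
            rw [mk_eq_iff]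
            obtain ⟨h1, h2, h3, h4⟩ := h
            rcases hs with rfl | rfl
            · left; ext i j; fin_cases i <;> fin_cases j <;> simp [h1, h2, h3, h4]
            · right; ext i j; fin_cases i <;> fin_cases j <;> simp [h1, h2, h3, h4]
          · right
            rw [Subtype.ext_iff, eq_comm]
            change (QuotientGroup.mk g⁻¹ : PGL2Z) = QuotientGroup.mk k
            have hgi : (g⁻¹).val = !![g.val 1 1, -g.val 0 1; -g.val 1 0, g.val 0 0] := by
              rw [Matrix.coe_units_inv, Matrix.inv_def, hd, Matrix.adjugate_fin_two]; simp
            rw [mk_eq_iff, hgi]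
            obtain ⟨h1, h2, h3, h4⟩ := h
            rcases hs with rfl | rfl
            · left; ext i j; fin_cases i <;> fin_cases j <;> simp [h1, h2, h3, h4]
            · right; ext i j; fin_cases i <;> fin_cases j <;> simp [h1, h2, h3, h4]
    · refine ⟨1, ?_⟩
      rintro ⟨y, hy⟩ hyk
      induction y using QuotientGroup.induction_on with
      | H k =>
        have hkd := (hφ k hy).1 hyk
        left; ext
        refine hone k hy hkd ?_
        by_contra h0
        exact hex ⟨k, hy, hkd, h0⟩
  obtain ⟨x, hx⟩ := hx
  refine fin_abs φ x hx ?_ hnt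
  rintro ⟨y, hy⟩ hyk
  induction y using QuotientGroup.induction_on with
  | H k =>
    have hkd : k.val.det ≠ 1 := fun h => hyk ((hφ k hy).2 h)
    have hd : IsUnit (k.val.det) := (Matrix.isUnit_iff_isUnit_det _).1 k.isUnit
    have hd1 : k.val.det = -1 := (Int.isUnit_iff.1 hd).resolve_left hkd
    have hkk : (QuotientGroup.mk (k * k) : PGL2Z) ∈ H := H.mul_mem hy hy
    have hkkd : (k * k).val.det = 1 := by simp [hd1]
    have e := hrel (k * k) hkk hkkd
    have hb := arith_bd a b c _ _ _ _ ha hD e.1 e.2.1 e.2.2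
    rw [det_fin_two] at hd1
    simp only [Units.val_mul, Matrix.mul_apply, Fin.sum_univ_two] at hb
    have htr : k.val 0 0 + k.val 1 1 = 0 := by
      have e3 : k.val 0 0 * k.val 0 0 + k.val 0 1 * k.val 1 0 +
        (k.val 1 0 * k.val 0 1 + k.val 1 1 * k.val 1 1) = (k.val 0 0 + k.val 1 1) ^ 2 + 2 := by
        linear_combination (-2) * hd1
      rw [e3] at hb
      have := sq_nonneg (k.val 0 0 + k.val 1 1)
      nlinarith
    ext
    change (QuotientGroup.mk (k * k) : PGL2Z) = 1
    apply hone _ hkk hkkd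
    simp only [Units.val_mul, Matrix.mul_apply, Fin.sum_univ_two]
    linear_combination (k.val 1 0) * htr
end

section
/- If H is a subgroup of PGL(2,ℤ) of order 6 that contains the element [U], then H equals the subgroup G₆ generated by [U] and [S]. -/
open Matrix

lemma center_pm (z : GL2Z) (hz : z ∈ Subgroup.center GL2Z) :
    z.val = 1 ∨ z.val = -1 := by
  rw [Subgroup.mem_center_iff] at hz
  have h1 := congrArg Units.val (hz Smat)
  have h2 := congrArg Units.val (hz Umat)
  have hd : z.val.det = 1 ∨ z.val.det = -1 := by
    have := Int.isUnit_iff.mp ((Matrix.isUnit_iff_isUnit_det _).mp z.isUnit)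
    exact this
  obtain ⟨a, b, c, d, hM⟩ : ∃ a b c d : ℤ, z.val = !![a, b; c, d] :=
    ⟨_, _, _, _, Matrix.eta_fin_two z.val⟩
  simp only [Units.val_mul, hM, Smat, Umat] at h1 h2
  rw [hM, Matrix.det_fin_two_of] at hd
  have e1 := congrFun (congrFun h1 0) 0
  have e2 := congrFun (congrFun h1 0) 1
  have e3 := congrFun (congrFun h2 0) 0
  have e4 := congrFun (congrFun h2 0) 1
  simp [Matrix.mul_apply, Fin.sum_univ_two] at e1 e2 e3 e4
  have hb : b = 0 := by omega
  have hc : c = 0 := by omega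
  subst hb hc
  have had : a = d := by omega
  subst had
  have ha : a = 1 ∨ a = -1 := by
    rcases hd with hd | hd
    · exact mul_self_eq_one_iff.mp (by linarith)
    · nlinarith
  rw [hM]
  rcases ha with rfl | rfl
  · left; ext i j; fin_cases i <;> fin_cases j <;> rfl
  · right; ext i j; fin_cases i <;> fin_cases j <;> rfl

lemma cls_eq_of (M X : GL2Z) (h : M.val = X.val ∨ M.val = -X.val) : cls M = cls X := by
  rcases h with h | h
  · rw [Units.ext h]
  · have : M = X * (-1) := by ext1; simp [h]
    rw [this]
    refine (QuotientGroup.eq.mpr ?_).symm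
    rw [Subgroup.mem_center_iff]
    intro g
    simp

lemma of_cls_eq (M X : GL2Z) (h : cls M = cls X) : X.val = M.val ∨ X.val = -M.val := by
  have h1 := QuotientGroup.eq.mp h
  have h2 : X = M * (M⁻¹ * X) := by group
  rcases center_pm _ h1 with h3 | h3
  · left; rw [h2, Units.val_mul, h3, mul_one]
  · right; rw [h2, Units.val_mul, h3]; simp

lemma cls_mul (M X : GL2Z) : cls (M * X) = cls M * cls X := rfl
lemma cls_inv (M : GL2Z) : cls M⁻¹ = (cls M)⁻¹ := rfl
lemma cls_one : cls 1 = 1 := rfl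

lemma u_ne_one : cls Umat ≠ 1 := by
  intro h
  rcases of_cls_eq 1 Umat h.symm with h | h <;>
  · have := congrFun (congrFun h 0) 1
    simp [Umat] at this

lemma u_cube : cls Umat ^ 3 = 1 := by
  have : cls (Umat ^ 3) = cls 1 := by
    apply cls_eq_of
    right
    rw [Units.val_pow_eq_pow_val]
    simp only [Umat, Units.val_one]
    decide
  exact this

lemma small (a c : ℤ) (h : a * a + a * c + c * c = 1) :
    (a = 1 ∧ c = 0) ∨ (a = 0 ∧ c = 1) ∨ (a = 1 ∧ c = -1) ∨
    (a = -1 ∧ c = 0) ∨ (a = 0 ∧ c = -1) ∨ (a = -1 ∧ c = 1) := by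
  have h1 : a ≤ 1 := by nlinarith [sq_nonneg (a + 2 * c)]
  have h2 : -1 ≤ a := by nlinarith [sq_nonneg (a + 2 * c)]
  have h3 : c ≤ 1 := by nlinarith [sq_nonneg (c + 2 * a)]
  have h4 : -1 ≤ c := by nlinarith [sq_nonneg (c + 2 * a)]
  interval_cases a <;> interval_cases c <;> simp_all

lemma val_U : Umat.val = !![0,-1;1,1] := rfl
lemma val_Ui : (Umat⁻¹).val = !![1,1;-1,0] := rfl
lemma val_S : Smat.val = !![0,1;1,0] := rfl
lemma val_SU : (Smat * Umat).val = !![1,1;0,-1] := by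
  rw [Units.val_mul, val_S, val_U]; decide
lemma val_SUi : (Smat * Umat⁻¹).val = !![-1,0;1,1] := by
  rw [Units.val_mul, val_S, val_Ui]; decide

lemma normalizer_mem (M : GL2Z)
    (h : cls (M * Umat) = cls (Umat * M) ∨ cls (M * Umat) = cls (Umat⁻¹ * M)) :
    cls M ∈ ({cls 1, cls Umat, cls Umat⁻¹, cls Smat, cls (Smat * Umat),
      cls (Smat * Umat⁻¹)} : Set PGL2Z) := by
  have hd : M.val.det = 1 ∨ M.val.det = -1 :=
    Int.isUnit_iff.mp ((Matrix.isUnit_iff_isUnit_det _).mp M.isUnit)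
  obtain ⟨a, b, c, d, hM⟩ : ∃ a b c d : ℤ, M.val = !![a, b; c, d] :=
    ⟨_, _, _, _, Matrix.eta_fin_two M.val⟩
  rw [hM, Matrix.det_fin_two_of] at hd
  have key : (b = -c ∧ d = a + c) ∨ (b = a + c ∧ d = -a) := by
    rcases h with h | h <;> rcases of_cls_eq _ _ h with h | h <;>
    · simp only [Units.val_mul, hM, val_U, val_Ui] at h
      have e1 := congrFun (congrFun h 0) 0
      have e2 := congrFun (congrFun h 0) 1
      have e3 := congrFun (congrFun h 1) 0
      have e4 := congrFun (congrFun h 1) 1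
      simp [Matrix.mul_apply, Fin.sum_univ_two] at e1 e2 e3 e4
      first
      | (left; constructor <;> omega)
      | (right; constructor <;> omega)
  have hs : a * a + a * c + c * c = 1 := by
    rcases key with ⟨rfl, rfl⟩ | ⟨rfl, rfl⟩ <;> rcases hd with hd | hd <;>
      nlinarith [sq_nonneg (a + c), sq_nonneg a, sq_nonneg c]
  simp only [Set.mem_insert_iff, Set.mem_singleton_iff]
  rcases key with ⟨rfl, rfl⟩ | ⟨rfl, rfl⟩
  · rcases small a c hs with ⟨rfl, rfl⟩ | ⟨rfl, rfl⟩ | ⟨rfl, rfl⟩ | ⟨rfl, rfl⟩ | ⟨rfl, rfl⟩ | ⟨rfl, rfl⟩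
    · exact Or.inl (cls_eq_of _ _ (by rw [hM, Units.val_one]; decide))
    · exact Or.inr (Or.inl (cls_eq_of _ _ (by rw [hM, val_U]; decide)))
    · exact Or.inr (Or.inr (Or.inl (cls_eq_of _ _ (by rw [hM, val_Ui]; decide))))
    · exact Or.inl (cls_eq_of _ _ (by rw [hM, Units.val_one]; decide))
    · exact Or.inr (Or.inl (cls_eq_of _ _ (by rw [hM, val_U]; decide)))
    · exact Or.inr (Or.inr (Or.inl (cls_eq_of _ _ (by rw [hM, val_Ui]; decide))))
  · right; right; right
    rcases small a c hs with ⟨rfl, rfl⟩ | ⟨rfl, rfl⟩ | ⟨rfl, rfl⟩ | ⟨rfl, rfl⟩ | ⟨rfl, rfl⟩ | ⟨rfl, rfl⟩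
    · exact Or.inr (Or.inl (cls_eq_of _ _ (by rw [hM, val_SU]; decide)))
    · exact Or.inl (cls_eq_of _ _ (by rw [hM, val_S]; decide))
    · exact Or.inr (Or.inr (cls_eq_of _ _ (by rw [hM, val_SUi]; decide)))
    · exact Or.inr (Or.inl (cls_eq_of _ _ (by rw [hM, val_SU]; decide)))
    · exact Or.inl (cls_eq_of _ _ (by rw [hM, val_S]; decide))
    · exact Or.inr (Or.inr (cls_eq_of _ _ (by rw [hM, val_SUi]; decide)))

/-- In a group of order 6, an element of order 3 is conjugate only to itself and its inverse. -/
lemma conj_of_card {G : Type*} [Group G] (hG : Nat.card G = 6) (u h : G) (hu : u ≠ 1)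
    (h3 : u ^ 3 = 1) : h * u = u * h ∨ h * u = u⁻¹ * h := by
  have ho : orderOf u = 3 := orderOf_eq_prime h3 hu
  have hc : Nat.card (Subgroup.zpowers u) = 3 := by rw [Nat.card_zpowers, ho]
  have hi : (Subgroup.zpowers u).index = 2 := by
    have := (Subgroup.zpowers u).card_mul_index
    rw [hc, hG] at this
    omega
  have hn := Subgroup.normal_of_index_eq_two hi
  obtain ⟨k, hk⟩ := Subgroup.mem_zpowers_iff.mp (hn.conj_mem u (Subgroup.mem_zpowers u) h)
  rw [← zpow_mod_orderOf, ho] at hk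
  have hk0 : 0 ≤ k % 3 := by omega
  have hk1 : k % 3 < 3 := by omega
  have hcj : h * u = u ^ (k % ((3 : ℕ) : ℤ)) * h := by rw [hk]; group
  have : k % 3 = 0 ∨ k % 3 = 1 ∨ k % 3 = 2 := by omega
  rcases this with e | e | e
  · exfalso
    apply hu
    simp [e] at hcj
    exact hcj
  · left
    simpa [e] using hcj
  · right
    have : u⁻¹ = u ^ (2 : ℤ) := by
      rw [inv_eq_iff_mul_eq_one]
      rw [← h3]; group
    rw [this]
    simpa [e] using hcj

/-- A subgroup of PGL(2,ℤ) of order 6 containing [U] equals G₆ = ⟨[U],[S]⟩. -/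
theorem stmt_11 (H : Subgroup PGL2Z) (hH : Nat.card H = 6) (hU : cls Umat ∈ H) :
    H = Subgroup.closure {cls Umat, cls Smat} := by
  let N : Set PGL2Z := {cls 1, cls Umat, cls Umat⁻¹, cls Smat, cls (Smat * Umat),
      cls (Smat * Umat⁻¹)}
  have hsub : (H : Set PGL2Z) ⊆ N := by
    intro x hx
    obtain ⟨M, rfl⟩ := QuotientGroup.mk_surjective x
    apply normalizer_mem M
    rcases conj_of_card hH ⟨cls Umat, hU⟩ ⟨cls M, hx⟩
      (fun e => u_ne_one (congrArg Subtype.val e)) (Subtype.ext u_cube) with e | e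
    · left; exact congrArg Subtype.val e
    · right; exact congrArg Subtype.val e
  have hfin : N.Finite := Set.toFinite _
  have hN : N.ncard ≤ 6 := by
    have h1 := Set.ncard_insert_le (cls 1) {cls Umat, cls Umat⁻¹, cls Smat, cls (Smat * Umat),
      cls (Smat * Umat⁻¹)}
    have h2 := Set.ncard_insert_le (cls Umat) {cls Umat⁻¹, cls Smat, cls (Smat * Umat),
      cls (Smat * Umat⁻¹)}
    have h3 := Set.ncard_insert_le (cls Umat⁻¹) {cls Smat, cls (Smat * Umat),
      cls (Smat * Umat⁻¹)}
    have h4 := Set.ncard_insert_le (cls Smat) {cls (Smat * Umat), cls (Smat * Umat⁻¹)}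
    have h5 := Set.ncard_insert_le (cls (Smat * Umat)) {cls (Smat * Umat⁻¹)}
    have h6 := Set.ncard_singleton (cls (Smat * Umat⁻¹))
    change Set.ncard {cls 1, cls Umat, cls Umat⁻¹, cls Smat, cls (Smat * Umat),
      cls (Smat * Umat⁻¹)} ≤ 6
    omega
  have hHc : (H : Set PGL2Z).ncard = 6 := hH
  have heq : (H : Set PGL2Z) = N := Set.eq_of_subset_of_ncard_le hsub (by omega) hfin
  have hS : cls Smat ∈ H := by
    have : cls Smat ∈ (H : Set PGL2Z) := by rw [heq]; simp [N]
    exact this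
  apply le_antisymm
  · intro x hx
    have hu : cls Umat ∈ Subgroup.closure {cls Umat, cls Smat} :=
      Subgroup.subset_closure (by simp)
    have hs : cls Smat ∈ Subgroup.closure {cls Umat, cls Smat} :=
      Subgroup.subset_closure (by simp)
    rcases hsub hx with e | e | e | e | e | e <;> rw [e]
    · exact one_mem _
    · exact hu
    · exact inv_mem hu
    · exact hs
    · exact mul_mem hs hu
    · exact mul_mem hs (inv_mem hu)
  · rw [Subgroup.closure_le]
    rintro x (rfl | rfl)
    · exact hU
    · exact hS
end
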